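/- There exists c > 0 such that the following holds. Let m ≥ 1 and let S₀,…,S_m be disjoint subsets of ℤ² with #S_j ≤ 2^j for each j. Let j₁, j₂, j₃, j₄ ∈ {0,…,m} and let a₃ ≥ 0 be an integer. Then the number of rectangles (ξ₁,ξ₂,ξ₃,ξ₄) ∈ 𝒬⁰ ∩ (S_{j₁} × S_{j₂} × S_{j₃} × S_{j₄}) with four distinct vertices such that #(ℓ(ξ₂,ξ₃) ∩ S_{j₃}) < 2^{a₃+1}, where ℓ(ξ₂,ξ₃) is the line through ξ₂ and ξ₃, is at most c · 2^{j₁+j₂+a₃}. -/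

import Mathlib

open scoped BigOperators

noncomputable section

/-- Points of the integer lattice `ℤ²`. -/
abbrev Pt := ℤ × ℤ

/-- A quadruple of lattice points, viewed as a function on `Fin 4`
(indices taken cyclically). -/
abbrev Quad := Fin 4 → Pt

/-- The embedding `ℤ² ↪ ℝ²`. -/
def emb (ξ : Pt) : ℝ × ℝ := ((ξ.1 : ℝ), (ξ.2 : ℝ))

/-- An affine line in the plane `ℝ²`. -/
def IsLine (ℓ : Set (ℝ × ℝ)) : Prop :=
  ∃ p v : ℝ × ℝ, v ≠ 0 ∧ ℓ = {x | ∃ t : ℝ, x = p + t • v}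

/-- The line through two lattice points `p ≠ q` (a degenerate point if `p = q`). -/
def lineThrough (p q : Pt) : Set (ℝ × ℝ) :=
  {x | ∃ t : ℝ, x = emb p + t • (emb q - emb p)}

/-- The number of points of a finite set `T ⊂ ℤ²` on a set `ℓ ⊂ ℝ²`,
i.e. `#(ℓ ∩ T)`. -/
def lineCount (ℓ : Set (ℝ × ℝ)) (T : Finset Pt) : ℕ :=
  (ℓ ∩ (emb '' (T : Set Pt))).ncard

/-- `Q = (ξ₁,ξ₂,ξ₃,ξ₄)` is a parallelogram: `ξ₁ + ξ₃ = ξ₂ + ξ₄`. -/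
def IsPara (Q : Quad) : Prop := Q 0 + Q 2 = Q 1 + Q 3

/-- The dot product `(ξ₁ − ξ₂)·(ξ₁ − ξ₄)`. -/
def dotQ (Q : Quad) : ℤ :=
  ((Q 0).1 - (Q 1).1) * ((Q 0).1 - (Q 3).1) + ((Q 0).2 - (Q 1).2) * ((Q 0).2 - (Q 3).2)

/-- `τ_Q = ||ξ₁|² − |ξ₂|² + |ξ₃|² − |ξ₄|²| = 2|(ξ₁−ξ₂)·(ξ₁−ξ₄)|`. -/
def tauQ (Q : Quad) : ℤ := 2 * |dotQ Q|

/-- `Q` is a rectangle: a parallelogram with `τ_Q = 0`. Membership in `𝒬⁰`. -/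
def IsRect (Q : Quad) : Prop := IsPara Q ∧ dotQ Q = 0

/-- `f(Q) = f(ξ₁)f(ξ₂)f(ξ₃)f(ξ₄)`. -/
def fQ (f : Pt → ℝ) (Q : Quad) : ℝ := ∏ k : Fin 4, f (Q k)

/-- The weight `f = ∑_{j=0}^m λ_j 2^{−j/2} χ_{S_j}`. -/
def fWt (S : ℕ → Finset Pt) (lam : ℕ → ℝ) (m : ℕ) (ξ : Pt) : ℝ :=
  ∑ j ∈ Finset.range (m + 1), if ξ ∈ S j then lam j * (2 : ℝ) ^ (-(j : ℝ) / 2) else 0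

/-- `gcd((a,b)) = gcd(|a|,|b|)` for `(a,b) ∈ ℤ²`. -/
def gcdP (ξ : Pt) : ℕ := Int.gcd ξ.1 ξ.2

/-- `max{#(ℓ(ξ,η₁) ∩ S_j), #(ℓ(ξ,η₂) ∩ S_j)}`, where `η₁, η₂` are the two
neighboring vertices of `ξ` in a rectangle. -/
def crossMax (S : ℕ → Finset Pt) (j : ℕ) (ξ η₁ η₂ : Pt) : ℕ :=
  max (lineCount (lineThrough ξ η₁) (S j)) (lineCount (lineThrough ξ η₂) (S j))

/-- `ξ` lies in some `S_j`, `j ≤ m`, and is a vertex of type `α ∈ {1,2,3}`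
relative to its neighbors `η₁, η₂`: with `a := log₂ crossMax`, type 1 means
`a ≥ j/2 + C` (i.e. `crossMax ≥ 2^{j/2+C}`), type 2 means `1 ≤ a < j/2 + C`
(i.e. `2 ≤ crossMax < 2^{j/2+C}`), and type 3 means `a = 0` (`crossMax = 1`). -/
def VertexType (S : ℕ → Finset Pt) (C m : ℕ) (α : ℕ) (ξ η₁ η₂ : Pt) : Prop :=
  ∃ j ≤ m, ξ ∈ S j ∧
    ((α = 1 ∧ (2 : ℝ) ^ ((j : ℝ) / 2 + (C : ℝ)) ≤ (crossMax S j ξ η₁ η₂ : ℝ)) ∨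
     (α = 2 ∧ 2 ≤ crossMax S j ξ η₁ η₂ ∧
        (crossMax S j ξ η₁ η₂ : ℝ) < (2 : ℝ) ^ ((j : ℝ) / 2 + (C : ℝ))) ∨
     (α = 3 ∧ crossMax S j ξ η₁ η₂ = 1))

/-- The set `𝒬⁰_{α,β}`: rectangles with four distinct vertices, all in
`∪_{j=0}^m S_j`, with `ξ₁, ξ₂` of type `α` and `ξ₃, ξ₄` of type `β`. -/
def QZeroAB (S : ℕ → Finset Pt) (C m : ℕ) (α β : ℕ) : Set Quad :=
  {Q | IsRect Q ∧ Function.Injective Q ∧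
    VertexType S C m α (Q 0) (Q 1) (Q 3) ∧
    VertexType S C m α (Q 1) (Q 2) (Q 0) ∧
    VertexType S C m β (Q 2) (Q 3) (Q 1) ∧
    VertexType S C m β (Q 3) (Q 0) (Q 2)}

/-- The set `𝒬⁰(j⃗, a⃗)`: rectangles with distinct vertices `ξ_k ∈ S_{j_k}` such
that for each `k` (cyclically), `2^{a_k} ≤ max{#(ℓ(ξ_k,ξ_{k+1}) ∩ S_{j_k}),
#(ℓ(ξ_k,ξ_{k−1}) ∩ S_{j_k})} < 2^{a_k+1}`. -/
def QZeroJA (S : ℕ → Finset Pt) (j a : Fin 4 → ℕ) : Set Quad :=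
  {Q | IsRect Q ∧ Function.Injective Q ∧ (∀ k, Q k ∈ S (j k)) ∧
    ∀ k : Fin 4,
      2 ^ (a k) ≤ max (lineCount (lineThrough (Q k) (Q (k + 1))) (S (j k)))
          (lineCount (lineThrough (Q k) (Q (k - 1))) (S (j k))) ∧
        max (lineCount (lineThrough (Q k) (Q (k + 1))) (S (j k)))
          (lineCount (lineThrough (Q k) (Q (k - 1))) (S (j k))) < 2 ^ (a k + 1)}


theorem emb_injective : Function.Injective emb := by
  rintro ⟨a, b⟩ ⟨c, d⟩ h
  simpa [emb] using h

/-- Two integer vectors orthogonal to a common nonzero vector are parallel. -/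
theorem mul_eq_mul_of_common_orthogonal {d u w : Pt} (hd : d ≠ 0)
    (hu : d.1 * u.1 + d.2 * u.2 = 0) (hw : d.1 * w.1 + d.2 * w.2 = 0) :
    u.1 * w.2 = u.2 * w.1 := by
  have h₁ : d.1 * (u.1 * w.2 - u.2 * w.1) = 0 := by linear_combination w.2 * hu - u.2 * hw
  have h₂ : d.2 * (u.1 * w.2 - u.2 * w.1) = 0 := by linear_combination u.1 * hw - w.1 * hu
  rcases mul_eq_zero.mp h₁ with h | h
  · rcases mul_eq_zero.mp h₂ with h' | h'
    · exact absurd (Prod.ext h h') hd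
    · exact sub_eq_zero.mp h'
  · exact sub_eq_zero.mp h

theorem emb_mem_lineThrough {q r s : Pt} (hr : q ≠ r)
    (h : (r.1 - q.1) * (s.2 - q.2) = (r.2 - q.2) * (s.1 - q.1)) :
    emb s ∈ lineThrough q r := by
  obtain ⟨q₁, q₂⟩ := q
  obtain ⟨r₁, r₂⟩ := r
  obtain ⟨s₁, s₂⟩ := s
  have h' : ((r₁ : ℝ) - q₁) * (s₂ - q₂) = (r₂ - q₂) * (s₁ - q₁) := by exact_mod_cast h
  have hne : ((r₁ : ℝ) - q₁) ^ 2 + (r₂ - q₂) ^ 2 ≠ 0 := by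
    intro h0
    apply hr
    have e₁ : (r₁ : ℝ) = q₁ := by nlinarith [sq_nonneg ((r₁ : ℝ) - q₁), sq_nonneg ((r₂ : ℝ) - q₂)]
    have e₂ : (r₂ : ℝ) = q₂ := by nlinarith [sq_nonneg ((r₁ : ℝ) - q₁), sq_nonneg ((r₂ : ℝ) - q₂)]
    exact Prod.ext (by exact_mod_cast e₁.symm) (by exact_mod_cast e₂.symm)
  refine ⟨((r₁ - q₁) * (s₁ - q₁) + (r₂ - q₂) * (s₂ - q₂)) /
    ((r₁ - q₁) ^ 2 + (r₂ - q₂) ^ 2), Prod.ext ?_ ?_⟩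
  · simp only [emb, Prod.fst_add, Prod.smul_fst, Prod.fst_sub, smul_eq_mul]
    field_simp
    linear_combination (-((r₂ : ℝ) - q₂)) * h'
  · simp only [emb, Prod.snd_add, Prod.smul_snd, Prod.snd_sub, smul_eq_mul]
    field_simp
    linear_combination ((r₁ : ℝ) - q₁) * h'

theorem IsRect.orthogonal {Q : Quad} (h : IsRect Q) :
    (Q 0 - Q 1).1 * (Q 2 - Q 1).1 + (Q 0 - Q 1).2 * (Q 2 - Q 1).2 = 0 := by
  obtain ⟨hp, hd⟩ := h
  have h₁ : (Q 0).1 + (Q 2).1 = (Q 1).1 + (Q 3).1 := congrArg Prod.fst hp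
  have h₂ : (Q 0).2 + (Q 2).2 = (Q 1).2 + (Q 3).2 := congrArg Prod.snd hp
  unfold dotQ at hd
  simp only [Prod.fst_sub, Prod.snd_sub]
  linear_combination ((Q 0).1 - (Q 1).1) * h₁ + ((Q 0).2 - (Q 1).2) * h₂ - hd

theorem IsPara.ext {Q R : Quad} (hQ : IsPara Q) (hR : IsPara R) (h₀ : Q 0 = R 0)
    (h₁ : Q 1 = R 1) (h₂ : Q 2 = R 2) : Q = R := by
  have h₃ : Q 3 = R 3 := by
    unfold IsPara at hQ hR
    rw [h₀, h₁, h₂, hR] at hQ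
    exact (add_left_cancel hQ).symm
  funext k
  fin_cases k <;> assumption

/-- If two rectangles share their first two vertices, the third vertex of one lies on the line
through the second and third vertices of the other. -/
theorem IsRect.emb_mem_lineThrough {Q R : Quad} (hQ : IsRect Q) (hR : IsRect R)
    (hQ₀ : Q 0 ≠ Q 1) (hQ₁ : Q 1 ≠ Q 2) (h₀ : R 0 = Q 0) (h₁ : R 1 = Q 1) :
    emb (R 2) ∈ lineThrough (Q 1) (Q 2) := by
  have hR' := hR.orthogonal
  rw [h₀, h₁] at hR'
  exact _root_.emb_mem_lineThrough hQ₁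
    (mul_eq_mul_of_common_orthogonal (sub_ne_zero.mpr hQ₀) hQ.orthogonal hR')

/-- Rectangles with first two vertices in `A` and `B`, and with at most `n` points of `C` on the
side line carrying the third vertex, number at most `n * (#A * #B)`. -/
theorem ncard_rect_le (A B C : Finset Pt) (n : ℕ) (𝒜 : Set Quad)
    (h : ∀ Q ∈ 𝒜, IsRect Q ∧ Function.Injective Q ∧ Q 0 ∈ A ∧ Q 1 ∈ B ∧ Q 2 ∈ C ∧
      lineCount (lineThrough (Q 1) (Q 2)) C ≤ n) :
    𝒜.ncard ≤ n * (A.card * B.card) := by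
  classical
  have hfin : 𝒜.Finite := by
    refine Set.Finite.of_finite_image (f := fun Q : Quad => (Q 0, Q 1, Q 2))
      ((A ×ˢ B ×ˢ C).finite_toSet.subset ?_) ?_
    · rintro _ ⟨Q, hQ, rfl⟩
      obtain ⟨-, -, hA, hB, hC, -⟩ := h Q hQ
      simp [hA, hB, hC]
    · intro Q hQ R hR hQR
      simp only [Prod.mk.injEq] at hQR
      exact (h Q hQ).1.1.ext (h R hR).1.1 hQR.1 hQR.2.1 hQR.2.2
  rw [Set.ncard_eq_toFinset_card 𝒜 hfin, ← Finset.card_product]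
  refine Finset.card_le_mul_card_image_of_maps_to (f := fun Q : Quad => (Q 0, Q 1)) ?_ n ?_
  · intro Q hQ
    obtain ⟨-, -, hA, hB, -, -⟩ := h Q (hfin.mem_toFinset.mp hQ)
    simp [hA, hB]
  · rintro ⟨p, q⟩ -
    rcases Finset.eq_empty_or_nonempty {Q ∈ hfin.toFinset | (Q 0, Q 1) = (p, q)} with h0 | ⟨Q, hQ⟩
    · rw [h0]
      exact Nat.zero_le n
    · simp only [Finset.mem_filter, hfin.mem_toFinset, Prod.mk.injEq] at hQ
      obtain ⟨hQ, hQp, hQq⟩ := hQ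
      obtain ⟨hrect, hinj, -, -, -, hcount⟩ := h Q hQ
      refine le_trans ?_ hcount
      rw [lineCount, ← Set.ncard_coe_finset]
      refine Set.ncard_le_ncard_of_injOn (fun R => emb (R 2)) ?_ ?_
        ((C.finite_toSet.image emb).inter_of_right _)
      · intro R hR
        simp only [Finset.coe_filter, hfin.mem_toFinset, Prod.mk.injEq, Set.mem_ofPred_eq] at hR
        obtain ⟨hR, hRp, hRq⟩ := hR
        obtain ⟨hRrect, -, -, -, hRC, -⟩ := h R hR
        exact ⟨hrect.emb_mem_lineThrough hRrect (hinj.ne (by decide)) (hinj.ne (by decide))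
          (hRp.trans hQp.symm) (hRq.trans hQq.symm), R 2, hRC, rfl⟩
      · intro R hR T hT hRT
        simp only [Finset.coe_filter, hfin.mem_toFinset, Prod.mk.injEq, Set.mem_ofPred_eq] at hR hT
        exact (h R hR.1).1.1.ext (h T hT.1).1.1 (hR.2.1.trans hT.2.1.symm)
          (hR.2.2.trans hT.2.2.symm) (emb_injective hRT)

/-- **Lemma 3.4.** The number of rectangles in `S_{j₁}×S_{j₂}×S_{j₃}×S_{j₄}` with
four distinct vertices and `#(ℓ(ξ₂,ξ₃) ∩ S_{j₃}) < 2^{a₃+1}` is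
`O(2^{j₁+j₂+a₃})`. -/
theorem rectangle_count_j1_j2_a3 :
    ∃ c : ℝ, 0 < c ∧
      ∀ (m : ℕ) (S : ℕ → Finset Pt),
        1 ≤ m →
        (∀ i ≤ m, ∀ j ≤ m, i ≠ j → Disjoint (S i) (S j)) →
        (∀ j ≤ m, (S j).card ≤ 2 ^ j) →
        ∀ j₁ j₂ j₃ j₄ : ℕ, j₁ ≤ m → j₂ ≤ m → j₃ ≤ m → j₄ ≤ m → ∀ a₃ : ℕ,
          ({Q : Quad | IsRect Q ∧ Function.Injective Q ∧
              Q 0 ∈ S j₁ ∧ Q 1 ∈ S j₂ ∧ Q 2 ∈ S j₃ ∧ Q 3 ∈ S j₄ ∧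
              lineCount (lineThrough (Q 1) (Q 2)) (S j₃) < 2 ^ (a₃ + 1)}.ncard : ℝ) ≤
            c * (2 : ℝ) ^ (j₁ + j₂ + a₃) := by
  refine ⟨2, by norm_num, ?_⟩
  intro m S _ _ hcard j₁ j₂ j₃ j₄ hj₁ hj₂ _ _ a₃
  have hle := (ncard_rect_le (S j₁) (S j₂) (S j₃) (2 ^ (a₃ + 1))
    {Q : Quad | IsRect Q ∧ Function.Injective Q ∧
      Q 0 ∈ S j₁ ∧ Q 1 ∈ S j₂ ∧ Q 2 ∈ S j₃ ∧ Q 3 ∈ S j₄ ∧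
      lineCount (lineThrough (Q 1) (Q 2)) (S j₃) < 2 ^ (a₃ + 1)}
    fun Q ⟨h, hi, h₀, h₁, h₂, _, hc⟩ => ⟨h, hi, h₀, h₁, h₂, hc.le⟩).trans
    (Nat.mul_le_mul_left _ (Nat.mul_le_mul (hcard j₁ hj₁) (hcard j₂ hj₂)))
  calc _ ≤ ((2 ^ (a₃ + 1) * (2 ^ j₁ * 2 ^ j₂) : ℕ) : ℝ) := by exact_mod_cast hle
    _ = 2 * (2 : ℝ) ^ (j₁ + j₂ + a₃) := by push_cast; ring
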